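/- Sierpinski's constant S = ln( 2π·e^{2γ}·Γ(3/4)²/Γ(1/4)² ) has the representations S = 2γ + (4/π)·∫₀¹ ln(−ln x)/(1 + x²) dx = 2γ + (2/π)·∫₀^∞ (ln x)/cosh x dx. -/

import Mathlib

open Real

/-- Sierpinski's constant. -/
noncomputable def sierpinskiS : ℝ :=
  Real.log (2 * π * Real.exp (2 * Real.eulerMascheroniConstant) *
    Real.Gamma (3 / 4) ^ 2 / Real.Gamma (1 / 4) ^ 2)

open Filter Topology MeasureTheory

noncomputable def gK (b x : ℝ) : ℝ := b / (b ^ 2 + x ^ 2)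

lemma gK_eq_re (b x : ℝ) : gK b x = (1 / ((b : ℂ) + x * Complex.I)).re := by
  rw [one_div, Complex.inv_re, Complex.normSq_apply, gK]
  simp [pow_two]

lemma gK_scale (c b x : ℝ) (hc : c ≠ 0) : gK (c * b) (c * x) = c⁻¹ * gK b x := by
  unfold gK
  rw [mul_pow, mul_pow, ← mul_add]
  field_simp

lemma gK_re (t x : ℝ) :
    (1 / (((t : ℂ)) + (x / (2 * π) : ℝ) * Complex.I)).re = 2 * π * gK (2 * π * t) x := by
  have hp := Real.pi_pos
  rw [← gK_eq_re]
  have := gK_scale (2 * π) t (x / (2 * π)) (by positivity)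
  rw [mul_div_cancel₀ _ (by positivity)] at this
  rw [this]; field_simp

lemma cot_re (x : ℝ) :
    (Complex.cot (π * (1 / 4 + (x / (2 * π) : ℝ) * Complex.I))).re = 1 / Real.cosh x := by
  have hp := Real.pi_pos
  have hp' : (π : ℂ) ≠ 0 := by exact_mod_cast hp.ne'
  set w : ℂ := π * (1 / 4 + (x / (2 * π) : ℝ) * Complex.I) with hw
  have hc : starRingEnd ℂ w = π / 2 - w := by
    rw [hw]
    simp only [map_mul, map_add, Complex.conj_ofReal, Complex.conj_I, map_div₀, map_one, map_ofNat]
    ring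
  have h2 : 2 * w = π / 2 + x * Complex.I := by
    rw [hw]; push_cast; field_simp; ring
  have hs : Complex.sin (2 * w) = Real.cosh x := by
    rw [h2, add_comm, Complex.sin_add_pi_div_two, Complex.cos_mul_I]; simp
  have hsw : 2 * Complex.sin w * Complex.cos w = Real.cosh x := by rw [← hs, Complex.sin_two_mul]
  have hcp : (Real.cosh x : ℂ) ≠ 0 := by exact_mod_cast (Real.cosh_pos x).ne'
  have hsn : Complex.sin w ≠ 0 := by rintro h; rw [h] at hsw; simp at hsw; exact hcp (by simpa using hsw.symm)
  have hcn : Complex.cos w ≠ 0 := by rintro h; rw [h] at hsw; simp at hsw; exact hcp (by simpa using hsw.symm)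
  have hcc : starRingEnd ℂ (Complex.cot w) = Complex.sin w / Complex.cos w := by
    rw [Complex.cot, map_div₀, ← Complex.cos_conj, ← Complex.sin_conj, hc, Complex.cos_pi_div_two_sub,
      Complex.sin_pi_div_two_sub]
  have := Complex.add_conj (Complex.cot w)
  rw [hcc, Complex.cot] at this
  have h3 : Complex.cos w / Complex.sin w + Complex.sin w / Complex.cos w = 2 / Real.cosh x := by
    rw [← hsw]
    field_simp
    linear_combination Complex.sin_sq_add_cos_sq w
  rw [h3] at this
  have h4 : 2 / Real.cosh x = 2 * (Complex.cos w / Complex.sin w).re := by exact_mod_cast this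
  rw [Complex.cot]
  linear_combination -h4 / 2

lemma sech_tendsto (x : ℝ) (hx : 0 < x) :
    Tendsto (fun n : ℕ => ∑ j ∈ Finset.range n,
      (gK (2 * π * (j + 5 / 4)) x - gK (2 * π * (j + 3 / 4)) x)) atTop
      (𝓝 (1 / (2 * Real.cosh x) - gK (2 * π * (1 / 4)) x)) := by
  have hp := Real.pi_pos
  have hu : (1 / 4 + (x / (2 * π) : ℝ) * Complex.I : ℂ) ∈ Complex.integerComplement := by
    rintro ⟨n, hn⟩
    have := congrArg Complex.im hn
    have h1 : (0 : ℝ) < x / (2 * π) := by positivity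
    have h2 : ((1 / 4 + (x / (2 * π) : ℝ) * Complex.I : ℂ)).im = x / (2 * π) := by
      rw [Complex.add_im, Complex.im_ofReal_mul]; simp
    rw [h2] at this
    simp only [Complex.intCast_im] at this
    linarith
  have h := (Complex.continuous_re.tendsto _).comp (tendsto_logDeriv_euler_cot_sub hu)
  have h' := h.const_mul (1 / (2 * π))
  refine (h'.congr ?_).trans (le_of_eq ?_)
  · intro n
    simp only [Function.comp, Complex.re_sum, Finset.mul_sum]
    refine Finset.sum_congr rfl fun j _ => ?_
    have e1 := gK_re (j + 5 / 4) x
    have e2 := gK_re (-(j + 3 / 4)) x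
    rw [Complex.add_re]
    have c1 : (1 / 4 + (x / (2 * π) : ℝ) * Complex.I : ℂ) + (j + 1) = ((j + 5 / 4 : ℝ) : ℂ) + (x / (2 * π) : ℝ) * Complex.I := by
      push_cast; ring
    have c2 : (1 / 4 + (x / (2 * π) : ℝ) * Complex.I : ℂ) - (j + 1) = ((-(j + 3 / 4) : ℝ) : ℂ) + (x / (2 * π) : ℝ) * Complex.I := by
      push_cast; ring
    rw [c1, c2, e1, e2]
    have : gK (2 * π * -(j + 3 / 4)) x = - gK (2 * π * (j + 3 / 4)) x := by
      unfold gK; rw [← neg_div]; congr 1 <;> ring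
    rw [this]; field_simp; ring
  · congr 1
    have e1 := gK_re (1 / 4) x
    have c1 : (((1 / 4 : ℝ) : ℂ)) = 1 / 4 := by push_cast; rfl
    rw [c1] at e1
    rw [Complex.sub_re, e1, Complex.re_ofReal_mul, cot_re]
    field_simp

noncomputable def hK (j : ℕ) (x : ℝ) : ℝ :=
  gK (2 * π * (j + 1 / 4)) x - 2 * gK (2 * π * (j + 3 / 4)) x + gK (2 * π * (j + 5 / 4)) x

lemma second_diff (b d x : ℝ) (hb : 0 < b) (hd : 0 < d) :
    |gK b x - 2 * gK (b + d) x + gK (b + 2 * d) x| ≤ 2 * d ^ 2 / b ^ 2 * gK b x := by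
  have key : ∀ c : ℝ, 0 < c → ((c : ℂ) + x * Complex.I) ≠ 0 := by
    intro c hc h
    have := congrArg Complex.re h
    simp at this
    linarith
  have nrm : ∀ c : ℝ, ‖((c : ℂ) + x * Complex.I)‖ ^ 2 = c ^ 2 + x ^ 2 := by
    intro c
    rw [← Complex.normSq_eq_norm_sq, Complex.normSq_apply]; simp [pow_two]
  have k1 := key b hb
  have k2 := key (b + d) (by positivity)
  have k3 := key (b + 2 * d) (by positivity)
  have : gK b x - 2 * gK (b + d) x + gK (b + 2 * d) x =
      (2 * d ^ 2 / (((b : ℂ) + x * Complex.I) * (((b + d : ℝ) : ℂ) + x * Complex.I) *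
        (((b + 2 * d : ℝ) : ℂ) + x * Complex.I))).re := by
    rw [gK_eq_re, gK_eq_re, gK_eq_re]
    have : ∀ z : ℂ, 2 * z.re = (2 * z).re := by intro z; simp
    rw [this, ← Complex.sub_re, ← Complex.add_re]
    congr 1
    push_cast at k2 k3 ⊢
    field_simp
    ring
  rw [this]
  refine (Complex.abs_re_le_norm _).trans ?_
  rw [norm_div, norm_mul (_ * _) _, norm_mul (_ + _) _]
  set A := ‖((b : ℂ) + x * Complex.I)‖
  set B := ‖(((b + d : ℝ) : ℂ) + x * Complex.I)‖
  set C := ‖(((b + 2 * d : ℝ) : ℂ) + x * Complex.I)‖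
  have hA : b ≤ A := by
    have := Complex.abs_re_le_norm ((b : ℂ) + x * Complex.I)
    simp at this
    exact (le_abs_self b).trans this
  have hAB : A ≤ B := by
    refine (sq_le_sq₀ (norm_nonneg _) (norm_nonneg _)).1 ?_
    rw [nrm, nrm]; nlinarith
  have hAC : A ≤ C := by
    refine (sq_le_sq₀ (norm_nonneg _) (norm_nonneg _)).1 ?_
    rw [nrm, nrm]; nlinarith
  have hN : ‖(2 * (d : ℂ) ^ 2)‖ = 2 * d ^ 2 := by
    simp [abs_of_pos hd]
  rw [hN, gK, ← nrm b]
  have hA0 : 0 < A := hb.trans_le hA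
  calc 2 * d ^ 2 / (A * B * C) ≤ 2 * d ^ 2 / (A * b * A) := by
        gcongr; exact hA.trans hAB
    _ = _ := by field_simp; rfl

lemma hK_bound (j : ℕ) (x : ℝ) :
    |hK j x| ≤ 2 * π ^ 2 / (2 * π * (j + 1 / 4)) ^ 2 * gK (2 * π * (j + 1 / 4)) x := by
  have := second_diff (2 * π * (j + 1 / 4)) π x (by positivity) Real.pi_pos
  convert this using 3
  unfold hK
  ring_nf
lemma logInt : IntegrableOn (fun x : ℝ => Real.log x * (1 + x ^ 2)⁻¹) (Set.Ioi 0) := by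
  rw [← Set.Ioc_union_Ioi_eq_Ioi (zero_le_one' ℝ)]
  refine IntegrableOn.union ?_ ?_
  · have h : IntegrableOn Real.log (Set.Ioc 0 1) := by
      have := intervalIntegral.intervalIntegrable_log' (a := 0) (b := 1)
      rwa [intervalIntegrable_iff_integrableOn_Ioc_of_le zero_le_one] at this
    refine Integrable.mono h (by fun_prop) ?_
    filter_upwards with x
    rw [norm_mul]
    refine mul_le_of_le_one_right (norm_nonneg _) ?_
    rw [norm_inv, Real.norm_of_nonneg (by positivity)]
    exact inv_le_one_of_one_le₀ (by nlinarith [sq_nonneg x])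
  · have h := (integrableOn_Ioi_rpow_of_lt (a := -3/2) (c := 1) (by norm_num) one_pos).const_mul 2
    refine Integrable.mono h (by fun_prop) ?_
    filter_upwards [ae_restrict_mem measurableSet_Ioi] with x hx
    have hx1 : (1 : ℝ) < x := hx
    have hx0 : 0 < x := by linarith
    rw [Real.norm_of_nonneg (by have := Real.log_nonneg hx1.le; positivity),
      Real.norm_of_nonneg (by positivity)]
    have h1 := Real.log_le_rpow_div hx0.le (ε := 1/2) (by norm_num)
    have h2 : (1 + x ^ 2)⁻¹ ≤ x ^ (-2 : ℝ) := by
      rw [Real.rpow_neg hx0.le]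
      gcongr
      norm_cast
      linarith
    calc Real.log x * (1 + x ^ 2)⁻¹ ≤ (x ^ (1/2 : ℝ) / (1/2)) * x ^ (-2 : ℝ) := by gcongr
      _ = 2 * (x ^ (1/2 : ℝ) * x ^ (-2 : ℝ)) := by ring
      _ = _ := by rw [← Real.rpow_add hx0]; norm_num

lemma logInt_zero : ∫ x in Set.Ioi (0 : ℝ), Real.log x * (1 + x ^ 2)⁻¹ = 0 := by
  have h := MeasureTheory.integral_comp_rpow_Ioi
    (fun x : ℝ => Real.log x * (1 + x ^ 2)⁻¹) (p := -1) (by norm_num)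
  have h2 : ∫ x in Set.Ioi (0 : ℝ), (|(-1 : ℝ)| * x ^ ((-1 : ℝ) - 1)) •
      (Real.log (x ^ (-1 : ℝ)) * (1 + (x ^ (-1 : ℝ)) ^ 2)⁻¹) =
      ∫ x in Set.Ioi (0 : ℝ), -(Real.log x * (1 + x ^ 2)⁻¹) := by
    refine setIntegral_congr_fun measurableSet_Ioi fun x hx => ?_
    have hx0 : (0 : ℝ) < x := hx
    have : x ^ ((-1 : ℝ) - 1) = (x ^ 2)⁻¹ := by
      rw [show (-1 : ℝ) - 1 = -2 by norm_num, Real.rpow_neg hx0.le]; norm_cast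
    simp only [this, Real.rpow_neg_one, Real.log_inv, smul_eq_mul, abs_neg, abs_one, one_mul]
    field_simp
    ring
  rw [h2, integral_neg] at h
  linarith

lemma logK_aux (b : ℝ) (hb : 0 < b) (x : ℝ) (hx : 0 < x) :
    Real.log (b * x) * gK b (b * x) =
      b⁻¹ * (Real.log b * (1 + x ^ 2)⁻¹ + Real.log x * (1 + x ^ 2)⁻¹) := by
  unfold gK
  rw [Real.log_mul hb.ne' hx.ne', mul_pow]
  have : b ^ 2 + b ^ 2 * x ^ 2 = b ^ 2 * (1 + x ^ 2) := by ring
  rw [this]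
  field_simp

lemma logK_sumInt (c : ℝ) : IntegrableOn (fun x : ℝ =>
    c * (1 + x ^ 2)⁻¹ + Real.log x * (1 + x ^ 2)⁻¹) (Set.Ioi 0) :=
  (integrable_inv_one_add_sq.integrableOn.const_mul c).add logInt

lemma logK_int (b : ℝ) (hb : 0 < b) :
    IntegrableOn (fun x : ℝ => Real.log x * gK b x) (Set.Ioi 0) := by
  have := integrableOn_Ioi_comp_mul_left_iff (fun x : ℝ => Real.log x * gK b x) 0 hb
  rw [mul_zero] at this
  rw [← this]
  refine IntegrableOn.congr_fun ((logK_sumInt (Real.log b)).const_mul b⁻¹) (fun x hx => ?_)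
    measurableSet_Ioi
  exact (logK_aux b hb x hx).symm

lemma logK_integral (b : ℝ) (hb : 0 < b) :
    ∫ x in Set.Ioi (0 : ℝ), Real.log x * gK b x = π / 2 * Real.log b := by
  have h := integral_comp_mul_left_Ioi (fun x : ℝ => Real.log x * gK b x) 0 hb
  rw [mul_zero] at h
  rw [setIntegral_congr_fun measurableSet_Ioi (fun x hx => logK_aux b hb x hx), integral_const_mul,
    integral_add (integrable_inv_one_add_sq.integrableOn.const_mul _) logInt, logInt_zero,
    integral_const_mul, integral_Ioi_inv_one_add_sq, smul_eq_mul] at h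
  have := mul_left_cancel₀ (inv_ne_zero hb.ne') h
  rw [← this]; simp; ring

lemma logK_abs (b : ℝ) (hb : 0 < b) :
    ∫ x in Set.Ioi (0 : ℝ), |Real.log x| * gK b x ≤
      π / 2 * |Real.log b| + ∫ x in Set.Ioi (0 : ℝ), |Real.log x| * (1 + x ^ 2)⁻¹ := by
  have i1 : IntegrableOn (fun x : ℝ => |Real.log x| * (1 + x ^ 2)⁻¹) (Set.Ioi 0) := by
    refine IntegrableOn.congr_fun logInt.norm (fun x hx => ?_) measurableSet_Ioi
    simp only [norm_mul, Real.norm_eq_abs]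
    congr 1
    exact abs_of_pos (by positivity)
  have i2 := (integrable_inv_one_add_sq.integrableOn (s := Set.Ioi 0)).const_mul |Real.log b|
  have h := integral_comp_mul_left_Ioi (fun x : ℝ => |Real.log x| * gK b x) 0 hb
  rw [mul_zero, smul_eq_mul] at h
  have h' : ∫ x in Set.Ioi (0 : ℝ), |Real.log x| * gK b x =
    ∫ x in Set.Ioi (0 : ℝ), |Real.log b * (1 + x ^ 2)⁻¹ + Real.log x * (1 + x ^ 2)⁻¹| := by
    have : ∫ x in Set.Ioi (0 : ℝ), |Real.log x| * gK b x =
      b * ∫ x in Set.Ioi (0 : ℝ), |Real.log (b * x)| * gK b (b * x) := by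
      rw [h]; field_simp
    rw [this, ← integral_const_mul]
    refine setIntegral_congr_fun measurableSet_Ioi fun x hx => ?_
    have e := logK_aux b hb x hx
    have g0 : 0 ≤ gK b (b * x) := by unfold gK; positivity
    have e2 : Real.log b * (1 + x ^ 2)⁻¹ + Real.log x * (1 + x ^ 2)⁻¹ =
      b * (Real.log (b * x) * gK b (b * x)) := by rw [e]; field_simp
    simp only [e2]
    rw [abs_mul, abs_mul, abs_of_pos hb, abs_of_nonneg g0]
  rw [h']
  have : ∫ x in Set.Ioi (0 : ℝ), (|Real.log b| * (1 + x ^ 2)⁻¹ + |Real.log x| * (1 + x ^ 2)⁻¹) =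
     π / 2 * |Real.log b| + ∫ x in Set.Ioi (0 : ℝ), |Real.log x| * (1 + x ^ 2)⁻¹ := by
    rw [integral_add i2 i1, integral_const_mul, integral_Ioi_inv_one_add_sq]
    simp; ring
  rw [← this]
  refine integral_mono (logK_sumInt _).abs (i2.add i1) fun x => ?_
  refine (abs_add_le _ _).trans (le_of_eq ?_)
  simp only [abs_mul, abs_inv]
  rw [abs_of_pos (show (0 : ℝ) < 1 + x ^ 2 by positivity)]

lemma subst_int : ∫ x in (0 : ℝ)..1, Real.log (-Real.log x) / (1 + x ^ 2) =
    1 / 2 * ∫ x in Set.Ioi (0 : ℝ), Real.log x / Real.cosh x := by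
  have him : (fun u : ℝ => Real.exp (-u)) '' Set.Ioi 0 = Set.Ioo 0 1 := by
    ext y
    constructor
    · rintro ⟨u, hu, rfl⟩
      exact ⟨Real.exp_pos _, by simpa using hu⟩
    · rintro ⟨h0, h1⟩
      exact ⟨-Real.log y, by simpa using Real.log_neg h0 h1, by simp [Real.exp_log h0]⟩
  have h := integral_image_eq_integral_abs_deriv_smul (s := Set.Ioi (0 : ℝ))
    (f := fun u : ℝ => Real.exp (-u)) (f' := fun u => -Real.exp (-u)) measurableSet_Ioi
    (fun x _ => by
      have := ((hasDerivAt_id x).neg.exp).hasDerivWithinAt (s := Set.Ioi 0)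
      simpa using this)
    (fun a _ b _ hab => by simpa using hab)
    (fun x : ℝ => Real.log (-Real.log x) / (1 + x ^ 2))
  rw [intervalIntegral.integral_of_le zero_le_one, integral_Ioc_eq_integral_Ioo, ← him, h,
    ← integral_const_mul]
  refine setIntegral_congr_fun measurableSet_Ioi fun x _ => ?_
  simp only [abs_neg, Real.abs_exp, Real.log_exp, neg_neg, smul_eq_mul]
  rw [Real.cosh_eq]
  have : Real.exp x * Real.exp (-x) = 1 := by rw [← Real.exp_add]; simp
  have h1 := Real.exp_pos x
  have h2 := Real.exp_pos (-x)
  have h3 : Real.exp x = (Real.exp (-x))⁻¹ := eq_inv_of_mul_eq_one_left this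
  rw [h3]
  field_simp
lemma sum_bJ (s : ℝ) (hs : 1 < s) : Summable (fun j : ℕ => ((2 * π * (j + 1 / 4)) ^ s)⁻¹) := by
  have h := ((Real.summable_one_div_nat_add_rpow (1 / 4) s).2 hs).mul_left ((2 * π) ^ s)⁻¹
  refine h.congr fun j => ?_
  have hj : (0 : ℝ) < j + 1 / 4 := by positivity
  rw [abs_of_pos hj, Real.mul_rpow (by positivity) hj.le, mul_inv, one_div]

lemma gK_nonneg (b x : ℝ) (hb : 0 < b) : 0 ≤ gK b x := by unfold gK; positivity

lemma hK_hasSum (x : ℝ) (hx : 0 < x) :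
    HasSum (fun j => hK j x) (1 / Real.cosh x - gK (2 * π * (1 / 4)) x) := by
  have hp := Real.pi_pos
  have hsum : Summable (fun j => hK j x) := by
    refine Summable.of_norm_bounded ((sum_bJ 2 (by norm_num)).mul_left
      (2 * π ^ 2 * (2 / π))) fun j => (hK_bound j x).trans ?_
    set b := 2 * π * ((j : ℝ) + 1 / 4) with hb
    have hb0 : 0 < b := by positivity
    have hb1 : π / 2 ≤ b := by
      rw [hb]; have : (0 : ℝ) ≤ j := by positivity
      nlinarith
    have : gK b x ≤ 2 / π := by
      unfold gK
      calc b / (b ^ 2 + x ^ 2) ≤ b / b ^ 2 := by gcongr; nlinarith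
        _ = 1 / b := by field_simp
        _ ≤ 1 / (π / 2) := by gcongr
        _ = 2 / π := by field_simp
    calc _ ≤ 2 * π ^ 2 / b ^ 2 * (2 / π) := by gcongr
      _ = _ := by norm_cast; ring
  rw [hsum.hasSum_iff_tendsto_nat]
  have h1 := (sech_tendsto x hx).const_mul 2
  have h2 : Tendsto (fun n : ℕ => gK (2 * π * (n + 1 / 4)) x) atTop (𝓝 0) := by
    have hlim : Tendsto (fun n : ℕ => 1 / ((n : ℝ) + 1)) atTop (𝓝 0) :=
      tendsto_one_div_add_atTop_nhds_zero_nat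
    have hb : Tendsto (fun n : ℕ => 2 * π * ((n : ℝ) + 1 / 4)) atTop atTop :=
      (tendsto_atTop_add_const_right _ _ tendsto_natCast_atTop_atTop).const_mul_atTop (by positivity)
    refine squeeze_zero (fun n => gK_nonneg _ _ (by positivity)) (fun n => ?_)
      (tendsto_inv_atTop_zero.comp hb)
    have hb0 : 0 < 2 * π * ((n : ℝ) + 1 / 4) := by positivity
    simp only [Function.comp]
    generalize 2 * π * ((n : ℝ) + 1 / 4) = b at hb0
    unfold gK
    calc b / (b ^ 2 + x ^ 2) ≤ b / b ^ 2 := by gcongr; nlinarith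
        _ = b⁻¹ := by field_simp
  have h3 := (h1.add_const (gK (2 * π * (1 / 4)) x)).sub h2
  have hlim : 2 * (1 / (2 * Real.cosh x) - gK (2 * π * (1 / 4)) x) + gK (2 * π * (1 / 4)) x - 0 =
      1 / Real.cosh x - gK (2 * π * (1 / 4)) x := by
    have := Real.cosh_pos x
    field_simp; ring
  rw [hlim] at h3
  refine h3.congr fun n => ?_
  induction n with
  | zero => simp
  | succ n ih =>
    rw [Finset.sum_range_succ, Finset.sum_range_succ, ← ih, hK]
    have : ((n + 1 : ℕ) : ℝ) + 1 / 4 = n + 5 / 4 := by push_cast; ring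
    rw [this]; ring

lemma logH_int (j : ℕ) : IntegrableOn (fun x : ℝ => Real.log x * hK j x) (Set.Ioi 0) ∧
    ∫ x in Set.Ioi (0 : ℝ), Real.log x * hK j x =
      π / 2 * (Real.log (2 * π * (j + 1 / 4)) - 2 * Real.log (2 * π * (j + 3 / 4)) +
        Real.log (2 * π * (j + 5 / 4))) := by
  have p1 : 0 < 2 * π * ((j : ℝ) + 1 / 4) := by positivity
  have p2 : 0 < 2 * π * ((j : ℝ) + 3 / 4) := by positivity
  have p3 : 0 < 2 * π * ((j : ℝ) + 5 / 4) := by positivity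
  have i1 := logK_int _ p1
  have i2 := (logK_int _ p2).const_mul 2
  have i3 := logK_int _ p3
  have e : (fun x : ℝ => Real.log x * hK j x) = fun x =>
      (Real.log x * gK (2 * π * (j + 1 / 4)) x - 2 * (Real.log x * gK (2 * π * (j + 3 / 4)) x)) +
        Real.log x * gK (2 * π * (j + 5 / 4)) x := by
    funext x; unfold hK; ring
  rw [e]
  refine ⟨(i1.sub i2).add i3, ?_⟩
  have i12 : Integrable (fun x : ℝ => Real.log x * gK (2 * π * (j + 1 / 4)) x -
      2 * (Real.log x * gK (2 * π * (j + 3 / 4)) x)) (volume.restrict (Set.Ioi 0)) := i1.sub i2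
  rw [integral_add i12 i3, integral_sub i1 i2, integral_const_mul, logK_integral _ p1,
    logK_integral _ p2, logK_integral _ p3]
  ring

lemma logH_norm_summable :
    Summable fun j : ℕ => ∫ x in Set.Ioi (0 : ℝ), ‖Real.log x * hK j x‖ := by
  have hp := Real.pi_pos
  have hp3 := Real.pi_gt_three
  set K := ∫ x in Set.Ioi (0 : ℝ), |Real.log x| * (1 + x ^ 2)⁻¹
  refine Summable.of_nonneg_of_le (fun j => integral_nonneg fun x => norm_nonneg _) (fun j => ?_)
    (((sum_bJ (3 / 2) (by norm_num)).mul_left (2 * π ^ 3)).add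
      ((sum_bJ 2 (by norm_num)).mul_left (2 * π ^ 2 * K)))
  have hB := hK_bound j
  have hi := (logH_int j).1
  set b := 2 * π * ((j : ℝ) + 1 / 4) with hb
  have hb0 : 0 < b := by positivity
  have hb1 : 1 ≤ b := by
    rw [hb]; have : (0 : ℝ) ≤ j := by positivity
    nlinarith
  have i1 : IntegrableOn (fun x : ℝ => |Real.log x| * gK b x) (Set.Ioi 0) := by
    refine IntegrableOn.congr_fun (logK_int b hb0).norm (fun x hx => ?_) measurableSet_Ioi
    simp only [norm_mul, Real.norm_eq_abs, abs_of_nonneg (gK_nonneg b x hb0)]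
  have hl0 := Real.log_nonneg hb1
  have hl := Real.log_le_rpow_div hb0.le (ε := 1 / 2) (by norm_num)
  have hbb : b ^ (1 / 2 : ℝ) * (b ^ 2)⁻¹ = (b ^ (3 / 2 : ℝ))⁻¹ := by
    rw [← Real.rpow_natCast b 2, ← Real.rpow_neg hb0.le, ← Real.rpow_neg hb0.le,
      ← Real.rpow_add hb0]
    norm_num
  calc ∫ x in Set.Ioi (0 : ℝ), ‖Real.log x * hK j x‖
      ≤ ∫ x in Set.Ioi (0 : ℝ), 2 * π ^ 2 / b ^ 2 * (|Real.log x| * gK b x) := by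
        refine integral_mono hi.norm (i1.const_mul _) fun x => ?_
        simp only [norm_mul, Real.norm_eq_abs]
        have := mul_le_mul_of_nonneg_left (hB x) (abs_nonneg (Real.log x))
        linarith
    _ = 2 * π ^ 2 / b ^ 2 * ∫ x in Set.Ioi (0 : ℝ), |Real.log x| * gK b x := integral_const_mul _ _
    _ ≤ 2 * π ^ 2 / b ^ 2 * (π / 2 * (b ^ (1 / 2 : ℝ) / (1 / 2)) + K) := by
        gcongr
        refine (logK_abs b hb0).trans ?_
        rw [abs_of_nonneg hl0]
        gcongr
    _ = 2 * π ^ 3 * (b ^ (1 / 2 : ℝ) * (b ^ 2)⁻¹) + 2 * π ^ 2 * K * (b ^ 2)⁻¹ := by ring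
    _ = _ := by rw [hbb]; norm_cast

lemma logCosh_int : IntegrableOn (fun x : ℝ => Real.log x / Real.cosh x) (Set.Ioi 0) := by
  refine Integrable.mono (logInt.const_mul 4) ?_ ?_
  · exact (by fun_prop : Measurable fun x : ℝ => Real.log x / Real.cosh x).aestronglyMeasurable
  · filter_upwards [ae_restrict_mem measurableSet_Ioi] with x hx
    have hx0 : (0 : ℝ) < x := hx
    have hc := Real.cosh_pos x
    rw [norm_div, norm_mul, norm_mul, Real.norm_of_nonneg hc.le, norm_inv,
      Real.norm_of_nonneg (show (0 : ℝ) ≤ 1 + x ^ 2 by positivity),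
      Real.norm_of_nonneg (show (0 : ℝ) ≤ 4 by norm_num)]
    have h1 := Real.quadratic_le_exp_of_nonneg hx0.le
    have h2 := Real.exp_pos (-x)
    have h3 : (1 + x ^ 2) / 4 ≤ Real.cosh x := by
      rw [Real.cosh_eq]; linarith [sq_nonneg x]
    calc ‖Real.log x‖ / Real.cosh x ≤ ‖Real.log x‖ / ((1 + x ^ 2) / 4) := by gcongr
      _ = _ := by field_simp

lemma main_hasSum : HasSum (fun j : ℕ => π / 2 * (Real.log (2 * π * (j + 1 / 4)) -
      2 * Real.log (2 * π * (j + 3 / 4)) + Real.log (2 * π * (j + 5 / 4))))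
    ((∫ x in Set.Ioi (0 : ℝ), Real.log x / Real.cosh x) - π / 2 * Real.log (2 * π * (1 / 4))) := by
  have h := hasSum_integral_of_summable_integral_norm (fun j => (logH_int j).1) logH_norm_summable
  have e : ∫ x in Set.Ioi (0 : ℝ), ∑' j, Real.log x * hK j x =
      (∫ x in Set.Ioi (0 : ℝ), Real.log x / Real.cosh x) - π / 2 * Real.log (2 * π * (1 / 4)) := by
    have p : 0 < 2 * π * (1 / 4) := by positivity
    rw [← logK_integral _ p, ← integral_sub logCosh_int (logK_int _ p)]
    refine setIntegral_congr_fun measurableSet_Ioi fun x hx => ?_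
    have := ((hK_hasSum x hx).mul_left (Real.log x)).tsum_eq
    simp only [this]
    ring
  rw [e] at h
  simpa only [(logH_int _).2] using h

lemma log_limit : Tendsto (fun n : ℕ => Real.log (2 * π * (1 / 4)) + ∑ j ∈ Finset.range n,
      (Real.log (2 * π * (j + 1 / 4)) - 2 * Real.log (2 * π * (j + 3 / 4)) +
        Real.log (2 * π * (j + 5 / 4)))) atTop
    (𝓝 (Real.log (2 * π) + 2 * (Real.log (Real.Gamma (3 / 4)) - Real.log (Real.Gamma (1 / 4))))) := by
  have hp := Real.pi_pos
  have t1 := Real.BohrMollerup.tendsto_log_gamma (x := 3 / 4) (by norm_num)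
  have t2 := Real.BohrMollerup.tendsto_log_gamma (x := 1 / 4) (by norm_num)
  have t3 := (Real.tendsto_log_comp_add_sub_log (1 / 4)).comp tendsto_natCast_atTop_atTop
  have t4 := (Real.tendsto_log_comp_add_sub_log (3 / 4)).comp tendsto_natCast_atTop_atTop
  have t := ((((t1.sub t2).const_mul 2).const_add (Real.log (2 * π))).sub t3).add (t4.const_mul 2)
  simp only [mul_zero, add_zero, sub_zero] at t
  refine t.congr fun n => ?_
  have e1 : Real.log (2 * π * (1 / 4)) + ∑ j ∈ Finset.range n,
      (Real.log (2 * π * (j + 1 / 4)) - 2 * Real.log (2 * π * (j + 3 / 4)) +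
        Real.log (2 * π * (j + 5 / 4))) = Real.log (2 * π) + Real.log (n + 1 / 4) +
      2 * (∑ j ∈ Finset.range n, Real.log (1 / 4 + j) - ∑ j ∈ Finset.range n, Real.log (3 / 4 + j)) := by
    have hm : ∀ t : ℝ, 0 < t → Real.log (2 * π * t) = Real.log (2 * π) + Real.log t :=
      fun t ht => Real.log_mul (by positivity) ht.ne'
    induction n with
    | zero => rw [hm _ (by norm_num)]; simp
    | succ n ih =>
      rw [Finset.sum_range_succ, ← add_assoc, ih, Finset.sum_range_succ, Finset.sum_range_succ,
        hm _ (by positivity), hm _ (by positivity), hm _ (by positivity)]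
      have : ((n + 1 : ℕ) : ℝ) + 1 / 4 = n + 5 / 4 := by push_cast; ring
      rw [this, add_comm (1 / 4 : ℝ) n, add_comm (3 / 4 : ℝ) n]
      ring
  rw [e1]
  simp only [Real.BohrMollerup.logGammaSeq, Finset.sum_range_succ, Function.comp]
  rw [add_comm (1 / 4 : ℝ) n, add_comm (3 / 4 : ℝ) n]
  ring

lemma main_integral : ∫ x in Set.Ioi (0 : ℝ), Real.log x / Real.cosh x =
    π / 2 * (Real.log (2 * π) +
      2 * (Real.log (Real.Gamma (3 / 4)) - Real.log (Real.Gamma (1 / 4)))) := by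
  have h1 := main_hasSum.tendsto_sum_nat
  have h2 := (log_limit.const_mul (π / 2)).sub_const (π / 2 * Real.log (2 * π * (1 / 4)))
  have := tendsto_nhds_unique h1 (h2.congr fun n => by rw [← Finset.mul_sum]; ring)
  linarith

theorem stmt16 :
    sierpinskiS = 2 * Real.eulerMascheroniConstant +
        (4 / π) * ∫ x in (0 : ℝ)..1, Real.log (-Real.log x) / (1 + x ^ 2) ∧
    sierpinskiS = 2 * Real.eulerMascheroniConstant +
        (2 / π) * ∫ x in Set.Ioi (0 : ℝ), Real.log x / Real.cosh x := by
  have hp := Real.pi_pos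
  have g1 : 0 < Real.Gamma (3 / 4) := Real.Gamma_pos_of_pos (by norm_num)
  have g2 : 0 < Real.Gamma (1 / 4) := Real.Gamma_pos_of_pos (by norm_num)
  have hS : sierpinskiS = 2 * Real.eulerMascheroniConstant + (Real.log (2 * π) +
      2 * (Real.log (Real.Gamma (3 / 4)) - Real.log (Real.Gamma (1 / 4)))) := by
    unfold sierpinskiS
    rw [Real.log_div (by positivity) (by positivity), Real.log_mul (by positivity) (by positivity),
      Real.log_mul (by positivity) (by positivity), Real.log_exp, Real.log_pow, Real.log_pow]
    push_cast; ring
  rw [subst_int, main_integral, hS]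
  constructor <;> field_simp
  ring
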